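/- Let r, c ≥ 1 and n = rc. The map SYT^stacked(2r×c) → S_{2n} given by S ↦ prom_r(S) is injective, where SYT^stacked(2r×c) denotes the subset of SYT(2r×c) consisting of all tableaux of the form stack(P,Q) with P, Q ∈ SYT(r×c). -/

import Mathlib

namespace PromRS

/-! ## Rectangular standard Young tableaux (as functions; 0-indexed cells; entries 1..R*C) -/

/-- `T` is a standard Young tableau of rectangular shape with `R` rows and `C` columns:
rows and columns strictly increase, and the entries on the `R × C` rectangle are a
bijection onto `{1, …, R*C}`. -/
def IsSYT (R C : ℕ) (T : ℕ → ℕ → ℕ) : Prop :=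
  (∀ i j, i < R → j + 1 < C → T i j < T i (j + 1)) ∧
  (∀ i j, i + 1 < R → j < C → T i j < T (i + 1) j) ∧
  Set.BijOn (fun p : ℕ × ℕ => T p.1 p.2) {p : ℕ × ℕ | p.1 < R ∧ p.2 < C} (Set.Icc 1 (R * C))

/-- Stacking: add `r*c` to every entry of `Q` and place the result below `P`. -/
def stack (r c : ℕ) (P Q : ℕ → ℕ → ℕ) : ℕ → ℕ → ℕ := fun i j =>
  if i < r then P i j else Q (i - r) j + r * c

/-! ## Gromotion and promotion permutations -/

/-- Value of `T` at a cell, with `⊤` outside the `R × C` rectangle. -/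
def ext (R C : ℕ) (T : ℕ → ℕ → ℕ) (p : ℕ × ℕ) : WithTop ℕ :=
  if p.1 < R ∧ p.2 < C then ((T p.1 p.2 : ℕ) : WithTop ℕ) else ⊤

/-- The jeu de taquin slide moves the empty cell to the smaller of its east/south neighbors. -/
def nextCell (R C : ℕ) (T : ℕ → ℕ → ℕ) (p : ℕ × ℕ) : ℕ × ℕ :=
  if ext R C T (p.1, p.2 + 1) < ext R C T (p.1 + 1, p.2) then (p.1, p.2 + 1)
  else (p.1 + 1, p.2)

/-- The sliding path of the empty cell, starting at the top-left corner. -/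
def slidePath (R C : ℕ) (T : ℕ → ℕ → ℕ) : ℕ → ℕ × ℕ
  | 0 => (0, 0)
  | k + 1 => nextCell R C T (slidePath R C T k)

def maxEntry (R C : ℕ) (T : ℕ → ℕ → ℕ) : ℕ :=
  ((Finset.range R) ×ˢ (Finset.range C)).sup fun p => T p.1 p.2

/-- Gromotion: delete the minimal entry (at the top-left corner), rectify by jeu de taquin
slides, and fill the vacated outer corner with (current maximum) + 1; entries are not
decremented. -/
def gromotion (R C : ℕ) (T : ℕ → ℕ → ℕ) : ℕ → ℕ → ℕ := fun i j =>
  if i = R - 1 ∧ j = C - 1 then maxEntry R C T + 1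
  else
    match (List.range (R + C - 2)).find? (fun k => decide (slidePath R C T k = (i, j))) with
    | some k => T (slidePath R C T (k + 1)).1 (slidePath R C T (k + 1)).2
    | none => T i j

/-- The entry that slides (up) into row `i` (1-indexed) during one gromotion slide of `T`:
the value of `T` at the first cell of the sliding path lying in 0-indexed row `i`. -/
def slideInto (R C : ℕ) (T : ℕ → ℕ → ℕ) (i : ℕ) : ℕ :=
  match (List.range (R + C - 1)).find? (fun k => decide ((slidePath R C T k).1 = i)) with
  | some k => T (slidePath R C T k).1 (slidePath R C T k).2
  | none => 0

/-- The `i`-th promotion permutation of `T ∈ SYT(R × C)`: its value at `j` is the entry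
that slides into row `i` when computing `gromotion^j(T)`, taken modulo `R*C` with
residues in `{1, …, R*C}`. -/
def promPerm (R C : ℕ) (T : ℕ → ℕ → ℕ) (i : ℕ) : ℕ → ℕ := fun j =>
  (slideInto R C ((gromotion R C)^[j - 1] T) i - 1) % (R * C) + 1

/-! ## Tableaux as lists of rows, Robinson–Schensted insertion -/

/-- Entry of a list-of-rows tableau (0-indexed; `0` outside). -/
def entryL (T : List (List ℕ)) (i j : ℕ) : ℕ := (T.getD i []).getD j 0

/-- Convert a function tableau on an `R × C` rectangle to a list of rows. -/
def toListT (R C : ℕ) (T : ℕ → ℕ → ℕ) : List (List ℕ) :=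
  (List.range R).map fun i => (List.range C).map fun j => T i j

/-- Transpose (conjugate) of a list-of-rows tableau. -/
def transposeT (T : List (List ℕ)) : List (List ℕ) :=
  (List.range (T.getD 0 []).length).map fun j => T.filterMap fun row => row[j]?

/-- Shape (row lengths) of a list-of-rows tableau. -/
def shapeL (T : List (List ℕ)) : List ℕ := T.map List.length

/-- Standard Young tableau, as a list of rows: weakly decreasing nonempty row lengths,
rows and columns strictly increasing, and entries exactly `{1, …, N}` where `N` is the
number of cells. -/
def IsSYTList (T : List (List ℕ)) : Prop :=
  (∀ i, i + 1 < T.length → (T.getD (i + 1) []).length ≤ (T.getD i []).length) ∧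
  (∀ row ∈ T, row ≠ []) ∧
  (∀ i j, i < T.length → j + 1 < (T.getD i []).length → entryL T i j < entryL T i (j + 1)) ∧
  (∀ i j, i + 1 < T.length → j < (T.getD (i + 1) []).length →
    entryL T i j < entryL T (i + 1) j) ∧
  T.flatten.Nodup ∧ (∀ m, m ∈ T.flatten ↔ 1 ≤ m ∧ m ≤ T.flatten.length)

/-- Schensted row insertion of `x` into a tableau. -/
def rowInsert : List (List ℕ) → ℕ → List (List ℕ)
  | [], x => [[x]]
  | r :: rs, x =>
    match r.dropWhile (fun y => decide (y < x)) with
    | [] => (r ++ [x]) :: rs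
    | y :: bs => (r.takeWhile (fun y => decide (y < x)) ++ x :: bs) :: rowInsert rs y

/-- The (0-indexed) row where the shape grew when passing from `P` to `P'`. -/
def rowOfNewCell (P P' : List (List ℕ)) : ℕ :=
  ((List.range P'.length).find? fun i =>
    decide ((P'.getD i []).length ≠ (P.getD i []).length)).getD 0

def placeInRow (Q : List (List ℕ)) (r k : ℕ) : List (List ℕ) :=
  if r < Q.length then Q.set r (Q.getD r [] ++ [k]) else Q ++ [[k]]

/-- The Robinson–Schensted correspondence: the pair (insertion tableau, recording tableau)
of a word. -/
def RS (w : List ℕ) : List (List ℕ) × List (List ℕ) :=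
  (List.range w.length).foldl
    (fun PQ i =>
      let P' := rowInsert PQ.1 (w.getD i 0)
      (P', placeInRow PQ.2 (rowOfNewCell PQ.1 P') (i + 1)))
    ([], [])

/-! ## Jeu de taquin on list tableaux; evacuation -/

def extL (T : List (List ℕ)) (p : ℕ × ℕ) : WithTop ℕ :=
  if p.2 < (T.getD p.1 []).length then ((entryL T p.1 p.2 : ℕ) : WithTop ℕ) else ⊤

def nextCellL (T : List (List ℕ)) (p : ℕ × ℕ) : ℕ × ℕ :=
  if extL T (p.1, p.2 + 1) = ⊤ ∧ extL T (p.1 + 1, p.2) = ⊤ then p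
  else if extL T (p.1, p.2 + 1) < extL T (p.1 + 1, p.2) then (p.1, p.2 + 1)
  else (p.1 + 1, p.2)

def jdtPath (T : List (List ℕ)) : ℕ → ℕ × ℕ
  | 0 => (0, 0)
  | k + 1 => nextCellL T (jdtPath T k)

/-- The outer corner vacated when the minimal entry of `T` is deleted and the tableau is
rectified by jeu de taquin slides. -/
def vacated (T : List (List ℕ)) : ℕ × ℕ := jdtPath T T.flatten.length

/-- The value at cell `(i, j)` after the rectification slide. -/
def slidValue (T : List (List ℕ)) (i j : ℕ) : ℕ :=
  match (List.range T.flatten.length).find? (fun k =>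
      decide (jdtPath T k = (i, j) ∧ jdtPath T (k + 1) ≠ (i, j))) with
  | some k => entryL T (jdtPath T (k + 1)).1 (jdtPath T (k + 1)).2
  | none => entryL T i j

/-- Delete the minimal entry of `T` and rectify. -/
def delta (T : List (List ℕ)) : List (List ℕ) :=
  ((List.range T.length).map fun i =>
    (List.range ((T.getD i []).length - if i = (vacated T).1 then 1 else 0)).map fun j =>
      slidValue T i j).filter fun row => decide (row ≠ [])

/-- The entry of the evacuation `∂T` at cell `(i,j)`: `n + 1 - k` where the `k`-th
deletion-rectification vacates `(i,j)`. -/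
def evacEntry (T : List (List ℕ)) (i j : ℕ) : ℕ :=
  match (List.range T.flatten.length).find? (fun k =>
      decide (vacated (delta^[k] T) = (i, j))) with
  | some k => T.flatten.length - k
  | none => 0

/-- Schützenberger evacuation `∂T` of a standard Young tableau. -/
def evacL (T : List (List ℕ)) : List (List ℕ) :=
  (List.range T.length).map fun i =>
    (List.range (T.getD i []).length).map fun j => evacEntry T i j

/-! ## Shadow lines, skeleta, and Viennot's construction -/

def dirNE (a b : ℤ × ℤ) : Prop := a.1 ≤ b.1 ∧ a.2 ≤ b.2
def dirSE (a b : ℤ × ℤ) : Prop := a.1 ≤ b.1 ∧ b.2 ≤ a.2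
def dirSW (a b : ℤ × ℤ) : Prop := b.1 ≤ a.1 ∧ b.2 ≤ a.2
def dirNW (a b : ℤ × ℤ) : Prop := b.1 ≤ a.1 ∧ a.2 ≤ b.2

def minimalsUnder (d : ℤ × ℤ → ℤ × ℤ → Prop) (P : Set (ℤ × ℤ)) : Set (ℤ × ℤ) :=
  {p ∈ P | ∀ q ∈ P, d q p → q = p}

/-- `P` minus its first `j` shadow lines. -/
def shadowRest (d : ℤ × ℤ → ℤ × ℤ → Prop) (P : Set (ℤ × ℤ)) : ℕ → Set (ℤ × ℤ)
  | 0 => P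
  | j + 1 => shadowRest d P j \ minimalsUnder d (shadowRest d P j)

/-- The `j`-th shadow line of `P` (1-indexed `j`). -/
def shadowLine (d : ℤ × ℤ → ℤ × ℤ → Prop) (P : Set (ℤ × ℤ)) (j : ℕ) : Set (ℤ × ℤ) :=
  minimalsUnder d (shadowRest d P (j - 1))

/-- The skeleton of a single shadow line `L`: the minimal elements of the set of points
covered by the shadows of at least two points of `L`. -/
def lineSkeleton (d : ℤ × ℤ → ℤ × ℤ → Prop) (L : Set (ℤ × ℤ)) : Set (ℤ × ℤ) :=
  minimalsUnder d {x | ∃ p ∈ L, ∃ q ∈ L, p ≠ q ∧ d p x ∧ d q x}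

/-- The skeleton of `P`: the union of the skeleta of its shadow lines. -/
def skeleton (d : ℤ × ℤ → ℤ × ℤ → Prop) (P : Set (ℤ × ℤ)) : Set (ℤ × ℤ) :=
  ⋃ j : ℕ, lineSkeleton d (shadowLine d P (j + 1))

/-- The `k`-th iterated skeleton of `P`. -/
def skeletonIter (d : ℤ × ℤ → ℤ × ℤ → Prop) (P : Set (ℤ × ℤ)) (k : ℕ) : Set (ℤ × ℤ) :=
  (skeleton d)^[k] P

def IsMinSnd (L : Set (ℤ × ℤ)) (y : ℤ) : Prop := (∃ p ∈ L, p.2 = y) ∧ ∀ p ∈ L, y ≤ p.2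
def IsMaxSnd (L : Set (ℤ × ℤ)) (y : ℤ) : Prop := (∃ p ∈ L, p.2 = y) ∧ ∀ p ∈ L, p.2 ≤ y
def IsMinFst (L : Set (ℤ × ℤ)) (x : ℤ) : Prop := (∃ p ∈ L, p.1 = x) ∧ ∀ p ∈ L, x ≤ p.1
def IsMaxFst (L : Set (ℤ × ℤ)) (x : ℤ) : Prop := (∃ p ∈ L, p.1 = x) ∧ ∀ p ∈ L, p.1 ≤ x

/-- The set of exit coordinates (specified by `spec`) of the shadow lines of the `i`-th
iterated skeleton of `P` in direction `d`. -/
def exitSet (spec : Set (ℤ × ℤ) → ℤ → Prop) (d : ℤ × ℤ → ℤ × ℤ → Prop)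
    (P : Set (ℤ × ℤ)) (i : ℕ) : Set ℤ :=
  {v | ∃ j : ℕ, spec (shadowLine d (skeletonIter d P i) (j + 1)) v}

/-- The word read off along one edge in Viennot's construction is the lattice word of the
standard tableau `T`: there is an enumeration `e` of all shadow-line exit coordinates,
in the order prescribed by `lt`, such that the `m`-th exit belongs to a shadow line of the
`i`-th iterated skeleton exactly when the entry `m` of `T` lies in row `i + 1`. -/
def ReadsWord (spec : Set (ℤ × ℤ) → ℤ → Prop) (lt : ℤ → ℤ → Prop)
    (d : ℤ × ℤ → ℤ × ℤ → Prop) (P : Set (ℤ × ℤ)) (T : List (List ℕ)) : Prop :=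
  ∃ e : Fin T.flatten.length → ℤ,
    (∀ a b : Fin T.flatten.length, a < b → lt (e a) (e b)) ∧
    (Set.range e = ⋃ i : ℕ, exitSet spec d P i) ∧
    ∀ (m : Fin T.flatten.length) (i : ℕ), e m ∈ exitSet spec d P i →
      (T.findIdx fun row => row.contains (m.1 + 1)) + 1 = i + 1

/-- `𝒱(𝒫, ↗) = (Pt, Qt)`: the P-word is read bottom-to-top along the right edge
(east exit heights, which are the minimal `y`-coordinates of the lines), the Q-word
left-to-right along the top edge (north exits at minimal `x`-coordinates). -/
def ViennotNE (P : Set (ℤ × ℤ)) (Pt Qt : List (List ℕ)) : Prop :=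
  ReadsWord IsMinSnd (· < ·) dirNE P Pt ∧ ReadsWord IsMinFst (· < ·) dirNE P Qt

/-- `𝒱(𝒫, ↘) = (Pt, Qt)`: P-word left-to-right along the bottom edge, Q-word
top-to-bottom along the right edge. -/
def ViennotSE (P : Set (ℤ × ℤ)) (Pt Qt : List (List ℕ)) : Prop :=
  ReadsWord IsMinFst (· < ·) dirSE P Pt ∧ ReadsWord IsMaxSnd (· > ·) dirSE P Qt

/-- `𝒱(𝒫, ↙) = (Pt, Qt)`: P-word bottom-to-top along the left edge, Q-word
right-to-left along the bottom edge. -/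
def ViennotSW (P : Set (ℤ × ℤ)) (Pt Qt : List (List ℕ)) : Prop :=
  ReadsWord IsMaxSnd (· < ·) dirSW P Pt ∧ ReadsWord IsMaxFst (· > ·) dirSW P Qt

/-- `𝒱(𝒫, ↖) = (Pt, Qt)`: P-word right-to-left along the top edge, Q-word
bottom-to-top along the left edge. -/
def ViennotNW (P : Set (ℤ × ℤ)) (Pt Qt : List (List ℕ)) : Prop :=
  ReadsWord IsMaxFst (· > ·) dirNW P Pt ∧ ReadsWord IsMinSnd (· < ·) dirNW P Qt

/-- The point set `𝒫^NE(ρ)` of the northeast `n × n` block of the permutation matrix of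
`ρ ∈ S_{2n}`, in Cartesian coordinates. -/
def pointsNE (n : ℕ) (f : ℕ → ℕ) : Set (ℤ × ℤ) :=
  {p | ∃ x : ℕ, 1 ≤ x ∧ x ≤ n ∧ n < f x ∧ p = ((f x : ℤ) - n, (n : ℤ) + 1 - x)}

/-! ## Crossings and nestings of perfect matchings -/

/-- The matching `{a, f a}` on `{1, …, N}` has a `k`-crossing:
blocks `{a₁ < b₁}, …, {a_k < b_k}` with `a₁ < ⋯ < a_k < b₁ < ⋯ < b_k`. -/
def HasCrossing (f : ℕ → ℕ) (N k : ℕ) : Prop :=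
  ∃ a b : Fin k → ℕ, StrictMono a ∧ StrictMono b ∧
    (∀ m, 1 ≤ a m ∧ b m ≤ N ∧ f (a m) = b m ∧ a m < b m) ∧
    ∀ m m' : Fin k, a m < b m'

/-- The matching `{a, f a}` on `{1, …, N}` has a `k`-nesting:
blocks `{a₁ < b₁}, …, {a_k < b_k}` with `a₁ < ⋯ < a_k < b_k < ⋯ < b₁`. -/
def HasNesting (f : ℕ → ℕ) (N k : ℕ) : Prop :=
  ∃ a b : Fin k → ℕ, StrictMono a ∧ StrictAnti b ∧
    (∀ m, 1 ≤ a m ∧ b m ≤ N ∧ f (a m) = b m ∧ a m < b m) ∧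
    ∀ m m' : Fin k, a m < b m'

/-! ## Local rules, the promotion–evacuation diagram, and the promotion matrix -/

/-- Partitions are encoded as lists of row lengths (fixed length, padded by zeros). -/
def sortDesc (l : List ℕ) : List ℕ := List.insertionSort (· ≥ ·) l

/-- The sequence `ν + κ - λ` (pointwise). -/
def ruleSeq (lam nu ka : List ℕ) : List ℕ :=
  List.zipWith (fun a b => a - b) (List.zipWith (· + ·) nu ka) lam

/-- The local rule: `μ = sort(ν + κ - λ)`. -/
def localRule (lam nu ka : List ℕ) : List ℕ := sortDesc (ruleSeq lam nu ka)

/-- The decoration of a local rule square: `i` if `ν + κ - λ` fails to be sorted at rows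
`i, i+1` (1-indexed), and `0` if no decoration is present. -/
def decoration (lam nu ka : List ℕ) : ℕ :=
  match (List.range (ruleSeq lam nu ka).length).find? (fun i =>
      decide ((ruleSeq lam nu ka).getD i 0 < (ruleSeq lam nu ka).getD (i + 1) 0)) with
  | some i => i + 1
  | none => 0

/-- Fill in the next row of the promotion–evacuation diagram from the previous row `prev`:
the new row starts with the empty partition at position `s` and continues by local rules. -/
def nextRow (R : ℕ) (prev : ℕ → List ℕ) (s : ℕ) : ℕ → List ℕ
  | 0 => List.replicate R 0
  | x + 1 =>
    if x + 1 ≤ s then List.replicate R 0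
    else localRule (prev x) (prev (x + 1)) (nextRow R prev s x)

/-- The `j`-th row of the promotion–evacuation diagram of `T ∈ SYT(R × C)`, as a function
of the column index (row `0` is the chain of `T`). -/
def PErow (R C : ℕ) (T : ℕ → ℕ → ℕ) : ℕ → ℕ → List ℕ
  | 0 => fun x => (List.range R).map fun i =>
      ((Finset.range C).filter fun j => T i j ≤ min x (R * C)).card
  | j + 1 => nextRow R (PErow R C T j) (j + 1)

/-- For `S = stack(P, Q) ∈ SYT(2r × c)` and `n = r*c`, the `(n+1) × (n+1)` northeast block
of partitions `λ(x, y)` of `PEdiagram(S)` (Cartesian coordinates): `λ(x,y)` is the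
diagram entry in row `n - y`, column `n + x`. -/
def lamBlock (r c : ℕ) (S : ℕ → ℕ → ℕ) (x y : ℕ) : List ℕ :=
  PErow (2 * r) c S (r * c - y) (r * c + x)

/-- The entry of `PM(S)^NE` at Cartesian coordinates `(x, y)`, `1 ≤ x, y ≤ n`: the
decoration of the local rule square with corners `λ(x-1, y-1)`, `λ(x-1, y)`, `λ(x, y-1)`,
`λ(x, y)`. -/
def PMNE (r c : ℕ) (S : ℕ → ℕ → ℕ) (x y : ℕ) : ℕ :=
  decoration (lamBlock r c S (x - 1) y) (lamBlock r c S x y) (lamBlock r c S (x - 1) (y - 1))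

/-- Chain of partitions of a list tableau: shape of the entries `≤ m`. -/
def chainOfL (T : List (List ℕ)) (m : ℕ) : List ℕ :=
  T.map fun row => (row.filter fun a => decide (a ≤ m)).length

/-- Column height `#{i : j < l i}` of a partition. -/
def colHeight (l : List ℕ) (j : ℕ) : ℕ := (l.filter fun a => decide (j < a)).length

/-- Vertical sum `l +' m` of two partitions (stack the columns of `m` onto those of `l`),
computed inside a `rows × cols` bounding box. -/
def vsum (rows cols : ℕ) (l m : List ℕ) : List ℕ :=
  (List.range rows).map fun i =>
    ((List.range cols).filter fun j => decide (i < colHeight l j + colHeight m j)).length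

/-! ## The point sets `S_k` and `S_{kj}` -/

/-- `x_{sj}`: the entry of `Q` in row `s`, column `j` (1-indexed). -/
def xEnt (Q : ℕ → ℕ → ℕ) (s j : ℕ) : ℤ := (Q (s - 1) (j - 1) : ℤ)

/-- `y_{tj}`: the entry of `∂(P)` in row `t`, column `j` (1-indexed). -/
def yEnt (r c : ℕ) (P : ℕ → ℕ → ℕ) (t j : ℕ) : ℤ :=
  (entryL (evacL (toListT r c P)) (t - 1) (j - 1) : ℤ)

def Skj (r c : ℕ) (P Q : ℕ → ℕ → ℕ) (k j : ℕ) : Set (ℤ × ℤ) :=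
  {p | ∃ s t : ℕ, 1 ≤ s ∧ s ≤ r ∧ 1 ≤ t ∧ t ≤ r ∧ s + t - 1 = k ∧
    p = (xEnt Q s j, yEnt r c P t j)}

def Sk (r c : ℕ) (P Q : ℕ → ℕ → ℕ) (k : ℕ) : Set (ℤ × ℤ) :=
  ⋃ j ∈ Set.Icc 1 c, Skj r c P Q k j

/-- A southeast chain of `k` ones in the matrix `U` (rows increase, columns increase),
contained in a rectangle that fully fits into the strictly upper triangular part of the
`N × N` matrix. -/
def HasSEChain (U : ℕ → ℕ → ℕ) (N k : ℕ) : Prop :=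
  ∃ a b : Fin k → ℕ, StrictMono a ∧ StrictMono b ∧ (∀ m, U (a m) (b m) = 1) ∧
    ∃ r₁ r₂ c₁ c₂ : ℕ, 1 ≤ r₁ ∧ r₂ < c₁ ∧ c₂ ≤ N ∧
      ∀ m, r₁ ≤ a m ∧ a m ≤ r₂ ∧ c₁ ≤ b m ∧ b m ≤ c₂

/-- A southwest chain of `k` ones in the matrix `U` (rows increase, columns decrease),
contained in a rectangle that fully fits into the strictly upper triangular part of the
`N × N` matrix. -/
def HasSWChain (U : ℕ → ℕ → ℕ) (N k : ℕ) : Prop :=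
  ∃ a b : Fin k → ℕ, StrictMono a ∧ StrictAnti b ∧ (∀ m, U (a m) (b m) = 1) ∧
    ∃ r₁ r₂ c₁ c₂ : ℕ, 1 ≤ r₁ ∧ r₂ < c₁ ∧ c₂ ≤ N ∧
      ∀ m, r₁ ≤ a m ∧ a m ≤ r₂ ∧ c₁ ≤ b m ∧ b m ≤ c₂

/-! ## Sliding paths -/

/-- Rows and columns of `T` strictly increase on the `R × C` rectangle, with distinct entries. -/
structure IsIncreasing (R C : ℕ) (T : ℕ → ℕ → ℕ) : Prop where
  row : ∀ i j, i < R → j + 1 < C → T i j < T i (j + 1)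
  col : ∀ i j, i + 1 < R → j < C → T i j < T (i + 1) j
  inj : ∀ i j i' j', i < R → j < C → i' < R → j' < C → T i j = T i' j' → i = i' ∧ j = j'

namespace IsIncreasing

variable {R C : ℕ} {T : ℕ → ℕ → ℕ}

theorem row_mono (hT : IsIncreasing R C T) {i j j' : ℕ} (hi : i < R) (hj : j ≤ j')
    (hj' : j' < C) : T i j ≤ T i j' := by
  induction j', hj using Nat.le_induction with
  | base => exact le_rfl
  | succ m _ ih => exact (ih (by omega)).trans (hT.row i m hi hj').le

theorem col_mono (hT : IsIncreasing R C T) {i i' j : ℕ} (hi : i ≤ i') (hi' : i' < R)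
    (hj : j < C) : T i j ≤ T i' j := by
  induction i', hi using Nat.le_induction with
  | base => exact le_rfl
  | succ m _ ih => exact (ih (by omega)).trans (hT.col m j hi' hj).le

theorem mono (hT : IsIncreasing R C T) {i i' j j' : ℕ} (hi : i ≤ i') (hi' : i' < R)
    (hj : j ≤ j') (hj' : j' < C) : T i j ≤ T i' j' :=
  (hT.row_mono (by omega) hj hj').trans (hT.col_mono hi hi' hj')

end IsIncreasing

theorem nextCell_eq_or (R C : ℕ) (T : ℕ → ℕ → ℕ) (p : ℕ × ℕ) :
    nextCell R C T p = (p.1, p.2 + 1) ∨ nextCell R C T p = (p.1 + 1, p.2) := by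
  unfold nextCell
  split_ifs <;> simp

theorem nextCell_spec {R C : ℕ} (T : ℕ → ℕ → ℕ) {p : ℕ × ℕ} (h1 : p.1 < R) (h2 : p.2 < C)
    (hp : p.1 + p.2 < R + C - 2) :
    (nextCell R C T p).1 < R ∧ (nextCell R C T p).2 < C ∧
    (p.2 + 1 < C → T (nextCell R C T p).1 (nextCell R C T p).2 ≤ T p.1 (p.2 + 1)) ∧
    (p.1 + 1 < R → T (nextCell R C T p).1 (nextCell R C T p).2 ≤ T (p.1 + 1) p.2) := by
  by_cases hr : p.2 + 1 < C <;> by_cases hd : p.1 + 1 < R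
  · by_cases hlt : T p.1 (p.2 + 1) < T (p.1 + 1) p.2
    · simp [nextCell, ext, hr, hd, h1, h2, hlt, hlt.le]
    · simp [nextCell, ext, hr, hd, h1, h2, hlt, not_lt.mp hlt]
  · simp [nextCell, ext, hr, hd, h1]
  · simp [nextCell, ext, hr, hd, h2]
  · omega

section Path

variable (R C : ℕ) (T : ℕ → ℕ → ℕ)

theorem slidePath_sum (k : ℕ) : (slidePath R C T k).1 + (slidePath R C T k).2 = k := by
  induction k with
  | zero => rfl
  | succ k ih =>
    rw [slidePath]
    rcases nextCell_eq_or R C T (slidePath R C T k) with h | h <;> rw [h] <;> simp <;> omega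

theorem slidePath_injective : Function.Injective (slidePath R C T) := fun a b h => by
  rw [← slidePath_sum R C T a, ← slidePath_sum R C T b, h]

theorem slidePath_mono {k l : ℕ} (h : k ≤ l) :
    (slidePath R C T k).1 ≤ (slidePath R C T l).1 ∧
    (slidePath R C T k).2 ≤ (slidePath R C T l).2 := by
  induction l, h using Nat.le_induction with
  | base => simp
  | succ m _ ih =>
    rw [slidePath]
    rcases nextCell_eq_or R C T (slidePath R C T m) with h | h <;> rw [h] <;> simp <;> omega

variable {R C}

theorem slidePath_mem (hR : 1 ≤ R) (hC : 1 ≤ C) {k : ℕ} (hk : k ≤ R + C - 2) :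
    (slidePath R C T k).1 < R ∧ (slidePath R C T k).2 < C := by
  induction k with
  | zero => simp [slidePath]; omega
  | succ k ih =>
    have h := ih (by omega)
    have hs := slidePath_sum R C T k
    have := nextCell_spec T h.1 h.2 (by omega)
    exact ⟨this.1, this.2.1⟩

theorem slidePath_last (hR : 1 ≤ R) (hC : 1 ≤ C) :
    slidePath R C T (R + C - 2) = (R - 1, C - 1) := by
  have h := slidePath_mem T hR hC le_rfl
  have hs := slidePath_sum R C T (R + C - 2)
  ext <;> simp <;> omega

theorem slidePath_succ_le (hR : 1 ≤ R) (hC : 1 ≤ C) {k : ℕ} (hk : k < R + C - 2) :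
    ((slidePath R C T k).2 + 1 < C →
      T (slidePath R C T (k + 1)).1 (slidePath R C T (k + 1)).2 ≤
        T (slidePath R C T k).1 ((slidePath R C T k).2 + 1)) ∧
    ((slidePath R C T k).1 + 1 < R →
      T (slidePath R C T (k + 1)).1 (slidePath R C T (k + 1)).2 ≤
        T ((slidePath R C T k).1 + 1) (slidePath R C T k).2) := by
  have h := slidePath_mem T hR hC hk.le
  have hs := slidePath_sum R C T k
  exact (nextCell_spec T h.1 h.2 (by omega)).2.2

variable {T}

theorem IsIncreasing.lt_along_slidePath (hT : IsIncreasing R C T) (U : ℕ → ℕ → ℕ)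
    (hR : 1 ≤ R) (hC : 1 ≤ C) {k : ℕ} (hk : k < R + C - 2) :
    T (slidePath R C U k).1 (slidePath R C U k).2 <
      T (slidePath R C U (k + 1)).1 (slidePath R C U (k + 1)).2 := by
  have h := slidePath_mem U hR hC hk.le
  have h' := slidePath_mem U hR hC (Nat.succ_le_of_lt hk)
  rw [Nat.succ_eq_add_one] at h'
  rw [slidePath] at h' ⊢
  rcases nextCell_eq_or R C U (slidePath R C U k) with e | e <;> rw [e] at h' ⊢
  · exact hT.row _ _ h.1 h'.2
  · exact hT.col _ _ h'.1 h.2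

theorem IsIncreasing.slidePath_lt (hT : IsIncreasing R C T) (hR : 1 ≤ R) (hC : 1 ≤ C) {k : ℕ}
    (hk : k < R + C - 2) :
    T (slidePath R C T k).1 (slidePath R C T k).2 <
      T (slidePath R C T (k + 1)).1 (slidePath R C T (k + 1)).2 :=
  hT.lt_along_slidePath T hR hC hk

theorem IsIncreasing.slidePath_le (hT : IsIncreasing R C T) (hR : 1 ≤ R) (hC : 1 ≤ C) {k l : ℕ}
    (hkl : k ≤ l) (hl : l ≤ R + C - 2) :
    T (slidePath R C T k).1 (slidePath R C T k).2 ≤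
      T (slidePath R C T l).1 (slidePath R C T l).2 := by
  have h := slidePath_mono R C T hkl
  have h' := slidePath_mem T hR hC hl
  exact hT.mono h.1 h'.1 h.2 h'.2

end Path

/-! ## Gromotion of increasing tableaux -/

theorem find?_range_eq_some {m k : ℕ} {p : ℕ → Bool} (hk : k < m) (hp : p k = true)
    (h : ∀ l < k, p l = false) : (List.range m).find? p = some k := by
  rw [List.find?_range_eq_some]
  exact ⟨hp, List.mem_range.mpr hk, fun l hl => by simp [h l hl]⟩

section Gromotion

variable {R C : ℕ} {T : ℕ → ℕ → ℕ}

theorem le_maxEntry {i j : ℕ} (hi : i < R) (hj : j < C) : T i j ≤ maxEntry R C T :=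
  Finset.le_sup (f := fun p : ℕ × ℕ => T p.1 p.2) (b := (i, j)) (by simp [hi, hj])

theorem gromotion_last : gromotion R C T (R - 1) (C - 1) = maxEntry R C T + 1 := by
  simp [gromotion]

theorem gromotion_slidePath {k : ℕ} (hk : k < R + C - 2) :
    gromotion R C T (slidePath R C T k).1 (slidePath R C T k).2 =
      T (slidePath R C T (k + 1)).1 (slidePath R C T (k + 1)).2 := by
  have hs := slidePath_sum R C T k
  have hf : (List.range (R + C - 2)).find? (fun l => decide (slidePath R C T l =
      ((slidePath R C T k).1, (slidePath R C T k).2))) = some k := by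
    refine find?_range_eq_some hk (by simp) fun l hl => ?_
    simp only [Prod.mk.eta, decide_eq_false_iff_not]
    exact fun e => hl.ne (slidePath_injective R C T e)
  rw [gromotion, if_neg (by omega), hf]

theorem gromotion_of_forall_ne {i j : ℕ} (hij : ¬(i = R - 1 ∧ j = C - 1))
    (h : ∀ k < R + C - 2, slidePath R C T k ≠ (i, j)) : gromotion R C T i j = T i j := by
  have hf : (List.range (R + C - 2)).find? (fun l => decide (slidePath R C T l = (i, j))) =
      none := by
    simpa [List.find?_eq_none] using h
  rw [gromotion, if_neg hij, hf]

theorem gromotion_cases (hR : 1 ≤ R) (hC : 1 ≤ C) (i j : ℕ) :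
    (i = R - 1 ∧ j = C - 1) ∨
    (∃ k < R + C - 2, slidePath R C T k = (i, j) ∧
      gromotion R C T i j = T (slidePath R C T (k + 1)).1 (slidePath R C T (k + 1)).2) ∨
    ((∀ k ≤ R + C - 2, slidePath R C T k ≠ (i, j)) ∧ gromotion R C T i j = T i j) := by
  by_cases hl : i = R - 1 ∧ j = C - 1
  · exact Or.inl hl
  by_cases hp : ∃ k < R + C - 2, slidePath R C T k = (i, j)
  · obtain ⟨k, hk, e⟩ := hp
    refine Or.inr (Or.inl ⟨k, hk, e, ?_⟩)
    rw [← gromotion_slidePath (T := T) hk, e]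
  · push Not at hp
    refine Or.inr (Or.inr ⟨fun k hk e => ?_, gromotion_of_forall_ne hl hp⟩)
    rcases hk.lt_or_eq with hk | rfl
    · exact hp k hk e
    · rw [slidePath_last T hR hC, Prod.mk.injEq] at e
      exact hl ⟨e.1.symm, e.2.symm⟩

theorem slideInto_eq {k i : ℕ} (hk : k < R + C - 2) (h : (slidePath R C T k).1 = i)
    (h' : (slidePath R C T (k + 1)).1 = i + 1) :
    slideInto R C T (i + 1) =
      T (slidePath R C T (k + 1)).1 (slidePath R C T (k + 1)).2 := by
  have hf : (List.range (R + C - 1)).find? (fun l => decide ((slidePath R C T l).1 = i + 1)) =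
      some (k + 1) := by
    refine find?_range_eq_some (by omega) (by simpa using h') fun l hl => ?_
    have := (slidePath_mono R C T (Nat.lt_succ_iff.mp hl)).1
    simp only [decide_eq_false_iff_not]
    omega
  rw [slideInto, hf]

theorem IsIncreasing.le_gromotion (hT : IsIncreasing R C T) (hR : 1 ≤ R) (hC : 1 ≤ C) {i j : ℕ}
    (hi : i < R) (hj : j < C) : T i j ≤ gromotion R C T i j := by
  rcases gromotion_cases (T := T) hR hC i j with ⟨rfl, rfl⟩ | ⟨k, hk, e, h⟩ | ⟨-, h⟩
  · rw [gromotion_last]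
    exact (le_maxEntry hi hj).trans (Nat.le_succ _)
  · have := hT.slidePath_lt hR hC hk
    rw [e] at this
    rw [h]
    exact this.le
  · exact h.ge

theorem IsIncreasing.lt_gromotion_slidePath (hT : IsIncreasing R C T) (hR : 1 ≤ R) (hC : 1 ≤ C)
    {k : ℕ} (hk : k ≤ R + C - 2) :
    T (slidePath R C T k).1 (slidePath R C T k).2 <
      gromotion R C T (slidePath R C T k).1 (slidePath R C T k).2 := by
  rcases hk.lt_or_eq with hk | rfl
  · rw [gromotion_slidePath hk]
    exact hT.slidePath_lt hR hC hk
  · rw [slidePath_last T hR hC, gromotion_last]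
    exact Nat.lt_succ_of_le (le_maxEntry (by omega) (by omega))

theorem IsIncreasing.gromotion_lt (hT : IsIncreasing R C T) (hR : 1 ≤ R) (hC : 1 ≤ C)
    {i j i' j' : ℕ} (hi' : i' < R) (hj' : j' < C)
    (hnext : i' = i ∧ j' = j + 1 ∨ i' = i + 1 ∧ j' = j) :
    gromotion R C T i j < gromotion R C T i' j' := by
  have hi : i < R := by omega
  have hj : j < C := by omega
  have hlt : T i j < T i' j' := by
    rcases hnext with ⟨rfl, rfl⟩ | ⟨rfl, rfl⟩
    · exact hT.row _ _ hi hj'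
    · exact hT.col _ _ hi' hj
  have hle := hT.le_gromotion hR hC hi' hj'
  rcases gromotion_cases (T := T) hR hC i j with ⟨rfl, rfl⟩ | ⟨k, hk, e, h⟩ | ⟨-, h⟩
  · omega
  · by_cases hq : slidePath R C T (k + 1) = (i', j')
    · have := hT.lt_gromotion_slidePath hR hC (Nat.succ_le_of_lt hk)
      rw [Nat.succ_eq_add_one, hq] at this
      rw [h, hq]
      exact this
    · have hs := slidePath_succ_le T hR hC hk
      have hm := slidePath_mem T hR hC (Nat.succ_le_of_lt hk)
      have hne : T (slidePath R C T (k + 1)).1 (slidePath R C T (k + 1)).2 ≠ T i' j' := by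
        intro heq
        have := hT.inj _ _ _ _ hm.1 hm.2 hi' hj' heq
        exact hq (Prod.ext this.1 this.2)
      rw [e] at hs
      have hle' : T (slidePath R C T (k + 1)).1 (slidePath R C T (k + 1)).2 ≤ T i' j' := by
        rcases hnext with ⟨rfl, rfl⟩ | ⟨rfl, rfl⟩
        · exact hs.1 hj'
        · exact hs.2 hi'
      omega
  · omega

theorem IsIncreasing.gromotion_inj (hT : IsIncreasing R C T) (hR : 1 ≤ R) (hC : 1 ≤ C)
    {i j i' j' : ℕ} (hi : i < R) (hj : j < C) (hi' : i' < R) (hj' : j' < C)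
    (h : gromotion R C T i j = gromotion R C T i' j') : i = i' ∧ j = j' := by
  have hmem {k : ℕ} (hk : k < R + C - 2) := slidePath_mem T hR hC (Nat.succ_le_of_lt hk)
  have hmax {k : ℕ} (hk : k < R + C - 2) :=
    le_maxEntry (T := T) (hmem hk).1 (hmem hk).2
  have hmax₁ := le_maxEntry (T := T) hi hj
  have hmax₂ := le_maxEntry (T := T) hi' hj'
  rcases gromotion_cases (T := T) hR hC i j with ⟨rfl, rfl⟩ | ⟨k, hk, e, g⟩ | ⟨e, g⟩ <;>
  rcases gromotion_cases (T := T) hR hC i' j' with ⟨rfl, rfl⟩ | ⟨k', hk', e', g'⟩ | ⟨e', g'⟩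
  · exact ⟨rfl, rfl⟩
  · rw [gromotion_last, g'] at h
    have := hmax hk'
    simp only [Nat.succ_eq_add_one] at this
    omega
  · rw [gromotion_last, g'] at h
    omega
  · rw [gromotion_last, g] at h
    have := hmax hk
    simp only [Nat.succ_eq_add_one] at this
    omega
  · rw [g, g'] at h
    have := hT.inj _ _ _ _ (hmem hk).1 (hmem hk).2 (hmem hk').1 (hmem hk').2 h
    have := slidePath_injective R C T (Prod.ext this.1 this.2)
    rw [Nat.succ_inj.mp this, e'] at e
    simpa [eq_comm] using e
  · rw [g, g'] at h
    have := hT.inj _ _ _ _ (hmem hk).1 (hmem hk).2 hi' hj' h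
    exact absurd (Prod.ext this.1 this.2) (e' (k + 1) hk)
  · rw [gromotion_last, g] at h
    omega
  · rw [g, g'] at h
    have := hT.inj _ _ _ _ hi hj (hmem hk').1 (hmem hk').2 h
    exact absurd (Prod.ext this.1.symm this.2.symm) (e (k' + 1) hk')
  · rw [g, g'] at h
    exact hT.inj _ _ _ _ hi hj hi' hj' h

theorem isIncreasing_gromotion (hT : IsIncreasing R C T) (hR : 1 ≤ R) (hC : 1 ≤ C) :
    IsIncreasing R C (gromotion R C T) where
  row _ _ hi hj := hT.gromotion_lt hR hC hi hj (Or.inl ⟨rfl, rfl⟩)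
  col _ _ hi hj := hT.gromotion_lt hR hC hi hj (Or.inr ⟨rfl, rfl⟩)
  inj _ _ _ _ hi hj hi' hj' h := hT.gromotion_inj hR hC hi hj hi' hj' h

theorem gromotion_slidePath_of_ne (hR : 1 ≤ R) (hC : 1 ≤ C) (U : ℕ → ℕ → ℕ) {k : ℕ}
    (hk : k < R + C - 2) (hne : slidePath R C T k ≠ slidePath R C U k) :
    gromotion R C T (slidePath R C U k).1 (slidePath R C U k).2 =
      T (slidePath R C U k).1 (slidePath R C U k).2 := by
  have hm := slidePath_sum R C U k
  refine gromotion_of_forall_ne (by omega) fun l _ e => hne ?_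
  have hl := slidePath_sum R C T l
  rw [e] at hl
  have : l = k := by simp only at hl; omega
  rw [← this, e, this]

/-- The part of `T` weakly before `v` on the sliding path is recovered from the gromotion of `T`
by sliding backwards from `v`. -/
theorem IsIncreasing.eq_of_gromotion_eq {U : ℕ → ℕ → ℕ} (hT : IsIncreasing R C T)
    (hU : IsIncreasing R C U) (hR : 1 ≤ R) (hC : 1 ≤ C) (L : ℕ → ℕ → Prop)
    (hL : ∀ i j i' j', L i j → i' ≤ i → j' ≤ j → L i' j')
    (h0 : T 0 0 = U 0 0) {a b : ℕ} (hab : L a b) (habl : a + b < R + C - 2)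
    (hTv : slidePath R C T (a + b) = (a, b)) (hUv : slidePath R C U (a + b) = (a, b))
    (hLv : ∀ k, a + b < k → k ≤ R + C - 2 → ¬ L (slidePath R C T k).1 (slidePath R C T k).2)
    (hLv' : ∀ k, a + b < k → k ≤ R + C - 2 → ¬ L (slidePath R C U k).1 (slidePath R C U k).2)
    (heq : ∀ i j, L i j → ¬(i = a ∧ j = b) →
      gromotion R C T i j = gromotion R C U i j) :
    ∀ i j, L i j → T i j = U i j := by
  have hpath : ∀ d ≤ a + b, slidePath R C T (a + b - d) = slidePath R C U (a + b - d) := by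
    intro d
    induction d with
    | zero => intro _; rw [Nat.sub_zero, hTv, hUv]
    | succ d ih =>
      intro hd
      have ih := ih (by omega)
      obtain ⟨k, hk⟩ : ∃ k, a + b - (d + 1) = k := ⟨_, rfl⟩
      rw [show a + b - d = k + 1 by omega] at ih
      rw [hk]
      by_contra hne
      have hkl : k < R + C - 2 := by omega
      have hmem : ∀ V : ℕ → ℕ → ℕ, slidePath R C V (a + b) = (a, b) →
          gromotion R C T (slidePath R C V k).1 (slidePath R C V k).2 =
            gromotion R C U (slidePath R C V k).1 (slidePath R C V k).2 := by
        intro V hV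
        have hm := slidePath_mono R C V (show k ≤ a + b by omega)
        have hs := slidePath_sum R C V k
        rw [hV] at hm
        exact heq _ _ (hL _ _ _ _ hab hm.1 hm.2) (by omega)
      have h1 := hmem T hTv
      have h2 := hmem U hUv
      rw [gromotion_slidePath hkl, gromotion_slidePath_of_ne hR hC T hkl (Ne.symm hne)] at h1
      rw [gromotion_slidePath hkl, gromotion_slidePath_of_ne hR hC U hkl hne] at h2
      have h3 := hT.lt_along_slidePath U hR hC hkl
      have h4 := hU.lt_along_slidePath T hR hC hkl
      rw [← ih] at h2 h3
      omega
  have hpath' : ∀ k ≤ a + b, slidePath R C T k = slidePath R C U k := by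
    intro k hk
    have := hpath (a + b - k) (by omega)
    rwa [Nat.sub_sub_self hk] at this
  intro i j hij
  by_cases hon : ∃ k ≤ R + C - 2, slidePath R C T k = (i, j)
  · obtain ⟨k, hk, e⟩ := hon
    have hkab : k ≤ a + b := by
      by_contra hlt
      exact hLv k (by omega) hk (by rwa [e])
    rcases k with _ | m
    · rw [slidePath, Prod.mk.injEq] at e
      rw [← e.1, ← e.2, h0]
    · have hm := slidePath_mono R C T (show m ≤ a + b by omega)
      have hs := slidePath_sum R C T m
      rw [hTv] at hm
      have := heq _ _ (hL _ _ _ _ hab hm.1 hm.2) (by omega)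
      rw [gromotion_slidePath (by omega), hpath' m (by omega), gromotion_slidePath (by omega),
        ← hpath' (m + 1) hkab, e] at this
      exact this
  · push Not at hon
    have hoff : ∀ k ≤ R + C - 2, slidePath R C U k ≠ (i, j) := by
      intro k hk e
      by_cases hkab : k ≤ a + b
      · exact hon k hk (by rw [hpath' k hkab, e])
      · exact hLv' k (by omega) hk (by rwa [e])
    have hlast : ¬(i = R - 1 ∧ j = C - 1) := by
      rintro ⟨rfl, rfl⟩
      exact hon _ le_rfl (slidePath_last T hR hC)
    have hne : ¬(i = a ∧ j = b) := by
      rintro ⟨rfl, rfl⟩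
      exact hon _ habl.le hTv
    have := heq i j hij hne
    rwa [gromotion_of_forall_ne hlast fun k hk => hon k hk.le,
      gromotion_of_forall_ne hlast fun k hk => hoff k hk.le] at this

end Gromotion

/-! ## Promotion of stacked tableaux -/

theorem IsSYT.isIncreasing {R C : ℕ} {T : ℕ → ℕ → ℕ} (hT : IsSYT R C T) :
    IsIncreasing R C T where
  row := hT.1
  col := hT.2.1
  inj i j i' j' hi hj hi' hj' h := by
    have := hT.2.2.injOn (x₁ := (i, j)) (x₂ := (i', j')) ⟨hi, hj⟩ ⟨hi', hj'⟩ h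
    simpa using this

theorem IsSYT.mem_Icc {R C : ℕ} {T : ℕ → ℕ → ℕ} (hT : IsSYT R C T) {i j : ℕ} (hi : i < R)
    (hj : j < C) : 1 ≤ T i j ∧ T i j ≤ R * C :=
  hT.2.2.mapsTo (x := (i, j)) ⟨hi, hj⟩

/-- The shape of the tableau `T` after `j` gromotions of `stack r c P Q`: in column `k` the
topmost `h k` entries come from `P`, and they are followed by the whole column `k` of `Q`. -/
structure StackState (r c : ℕ) (Q : ℕ → ℕ → ℕ) (h : ℕ → ℕ) (j : ℕ) (T : ℕ → ℕ → ℕ) : Prop where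
  increasing : IsIncreasing (2 * r) c T
  height_le : ∀ k, k < c → h k ≤ r
  le_iff : ∀ i k, i < 2 * r → k < c → (T i k ≤ r * c ↔ i < h k)
  middle : ∀ s k, s < r → k < c → T (h k + s) k = Q s k + r * c
  lower : ∀ i k, i < 2 * r → k < c → j < T i k
  surj : ∀ v, j < v → v ≤ r * c → ∃ i k, i < 2 * r ∧ k < c ∧ T i k = v

theorem stackState_stack {r c : ℕ} {P Q : ℕ → ℕ → ℕ} (hP : IsSYT r c P) (hQ : IsSYT r c Q) :
    StackState r c Q (fun _ => r) 0 (stack r c P Q) where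
  increasing :=
    { row := fun i j hi hj => by
        unfold stack
        split_ifs with h
        · exact hP.1 i j h hj
        · exact Nat.add_lt_add_right (hQ.1 _ j (by omega) hj) _
      col := fun i j hi hj => by
        unfold stack
        split_ifs with h h' h'
        · exact hP.2.1 i j h' hj
        · have := (hP.mem_Icc h hj).2
          have := (hQ.mem_Icc (i := i + 1 - r) (by omega) hj).1
          omega
        · omega
        · rw [Nat.sub_add_comm (by omega)]
          exact Nat.add_lt_add_right (hQ.2.1 _ j (by omega) hj) _
      inj := fun i j i' j' hi hj hi' hj' h => by
        unfold stack at h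
        split_ifs at h with h1 h2 h2
        · exact hP.isIncreasing.inj _ _ _ _ h1 hj h2 hj' h
        · have := (hP.mem_Icc h1 hj).2
          have := (hQ.mem_Icc (i := i' - r) (by omega) hj').1
          omega
        · have := (hP.mem_Icc h2 hj').2
          have := (hQ.mem_Icc (i := i - r) (by omega) hj).1
          omega
        · have := hQ.isIncreasing.inj _ _ _ _ (by omega) hj (by omega) hj'
            (Nat.add_right_cancel h)
          omega }
  height_le _ _ := le_rfl
  le_iff i k hi hk := by
    unfold stack
    split_ifs with h
    · simp [h, (hP.mem_Icc h hk).2]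
    · have := (hQ.mem_Icc (i := i - r) (by omega) hk).1
      omega
  middle s k _ _ := by simp [stack]
  lower i k hi hk := by
    unfold stack
    split_ifs with h
    · exact (hP.mem_Icc h hk).1
    · have := (hQ.mem_Icc (i := i - r) (by omega) hk).1
      omega
  surj v hv hv' := by
    obtain ⟨⟨i, k⟩, ⟨hi, hk⟩, e⟩ := hP.2.2.surjOn (show v ∈ Set.Icc 1 (r * c) from ⟨hv, hv'⟩)
    simp only at hi hk e
    exact ⟨i, k, by omega, hk, by simpa [stack, hi] using e⟩

namespace StackState

variable {r c j : ℕ} {Q T : ℕ → ℕ → ℕ} {h : ℕ → ℕ}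

theorem zero_zero (hS : StackState r c Q h j T) (hr : 1 ≤ r) (hc : 1 ≤ c) (hj : j < r * c) :
    T 0 0 = j + 1 := by
  obtain ⟨i, k, hi, hk, e⟩ := hS.surj (j + 1) (Nat.lt_succ_self j) hj
  have h1 := hS.increasing.mono (Nat.zero_le i) hi (Nat.zero_le k) hk
  have h2 := hS.lower 0 0 (by omega) hc
  omega

theorem height_antitone (hS : StackState r c Q h j T) {k k' : ℕ} (hk : k ≤ k') (hk' : k' < c) :
    h k' ≤ h k := by
  by_contra! hlt
  have := hS.height_le k' hk'
  have h1 := (hS.le_iff (h k) k' (by omega) hk').2 hlt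
  have h2 := hS.increasing.row_mono (i := h k) (by omega) hk hk'
  exact lt_irrefl _ ((hS.le_iff (h k) k (by omega) (by omega)).1 (h2.trans h1))

theorem height_eq_zero (hS : StackState r c Q h (r * c) T) (hr : 1 ≤ r) {k : ℕ} (hk : k < c) :
    h k = 0 := by
  have h1 := hS.le_iff 0 k (by omega) hk
  have h2 := hS.lower 0 k (by omega) hk
  omega

/-- The last cell of the sliding path with an entry coming from `P`. -/
theorem exists_corner (hS : StackState r c Q h j T) (hr : 1 ≤ r) (hc : 1 ≤ c)
    (hj : j < r * c) :
    ∃ k < c, 0 < h k ∧ slidePath (2 * r) c T (h k - 1 + k) = (h k - 1, k) ∧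
      (∀ m, h k - 1 + k < m → m ≤ 2 * r + c - 2 →
        r * c < T (slidePath (2 * r) c T m).1 (slidePath (2 * r) c T m).2) ∧
      (k + 1 < c → h (k + 1) < h k) := by
  have hR : 1 ≤ 2 * r := by omega
  have hT := hS.increasing
  have hlast : r * c < T (2 * r - 1) (c - 1) := by
    by_contra! hle
    have := (hS.le_iff (2 * r - 1) (c - 1) (by omega) (by omega)).1 hle
    have := hS.height_le (c - 1) (by omega)
    omega
  let p := fun m => T (slidePath (2 * r) c T m).1 (slidePath (2 * r) c T m).2
  have hex : ∃ m, r * c < p m :=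
    ⟨2 * r + c - 2, by simp only [p]; rw [slidePath_last T hR hc]; exact hlast⟩
  classical
  obtain ⟨m, hm⟩ : ∃ m, Nat.find hex = m + 1 := by
    refine Nat.exists_eq_succ_of_ne_zero fun h0 => ?_
    have := Nat.find_spec hex
    rw [h0] at this
    have h00 := hS.zero_zero hr hc hj
    simp only [p, slidePath] at this
    omega
  have hm1 : r * c < p (m + 1) := hm ▸ Nat.find_spec hex
  have hm0 : p m ≤ r * c := not_lt.1 (Nat.find_min hex (by omega))
  have hmlt : m < 2 * r + c - 2 := by
    have : Nat.find hex ≤ 2 * r + c - 2 := Nat.find_min' hex (by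
      simp only [p]; rw [slidePath_last T hR hc]; exact hlast)
    omega
  have hmem := slidePath_mem T hR hc hmlt.le
  have hsum := slidePath_sum (2 * r) c T m
  have hnext := slidePath_succ_le T hR hc hmlt
  obtain ⟨i, k, hik⟩ : ∃ i k, slidePath (2 * r) c T m = (i, k) := ⟨_, _, rfl⟩
  simp only [p] at hm0 hm1
  rw [hik] at hmem hsum hnext hm0
  simp only at hmem hsum hnext hm0
  have hik' := (hS.le_iff i k hmem.1 hmem.2).1 hm0
  have hle := hS.height_le k hmem.2
  have hdown := (hS.le_iff (i + 1) k (by omega) hmem.2).not.1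
    (not_le.2 (hm1.trans_le (hnext.2 (by omega))))
  have hik : slidePath (2 * r) c T (h k - 1 + k) = (h k - 1, k) := by
    rw [show h k - 1 = i by omega, hsum, hik]
  refine ⟨k, hmem.2, by omega, hik, fun l hl hl' => ?_, fun hk => ?_⟩
  · exact hm1.trans_le (hT.slidePath_le hR hc (by omega) hl')
  · have := (hS.le_iff i (k + 1) hmem.1 hk).not.1
      (not_le.2 (hm1.trans_le (hnext.1 hk)))
    omega

/-- After leaving the entries of `P`, the sliding path traverses a column of `Q` vertically. -/
theorem slidePath_vertical (hS : StackState r c Q h j T) (hQ : IsSYT r c Q) (hr : 1 ≤ r)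
    (hc : 1 ≤ c) {k : ℕ} (hk : k < c) (hpos : 0 < h k)
    (hv : slidePath (2 * r) c T (h k - 1 + k) = (h k - 1, k))
    (hnext : k + 1 < c → h (k + 1) < h k) {s : ℕ} (hs : s ≤ r) :
    slidePath (2 * r) c T (h k - 1 + k + s) = (h k - 1 + s, k) := by
  have hle := hS.height_le k hk
  induction s with
  | zero => exact hv
  | succ s ih =>
    have ih := ih (by omega)
    have hspec := slidePath_succ_le T (R := 2 * r) (by omega) hc
      (k := h k - 1 + k + s) (by omega)
    rcases nextCell_eq_or (2 * r) c T (slidePath (2 * r) c T (h k - 1 + k + s)) with e | e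
    · exfalso
      have hmem := slidePath_mem T (R := 2 * r) (by omega) hc
        (k := h k - 1 + k + s + 1) (by omega)
      rw [slidePath, e, ih] at hspec hmem
      simp only at hspec hmem
      have h1 := hspec.2 (by omega)
      rw [show h k - 1 + s + 1 = h k + s by omega, hS.middle s k (by omega) hk] at h1
      have h2 := hS.increasing.col_mono (i := h (k + 1) + s) (i' := h k - 1 + s) (j := k + 1)
        (by have := hnext hmem.2; omega) (by omega) hmem.2
      rw [hS.middle s (k + 1) (by omega) hmem.2] at h2
      have := hQ.1 s k (by omega) hmem.2
      omega
    · rw [← add_assoc, slidePath, e, ih]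
      simp only [Prod.mk.injEq, and_true]
      omega

theorem step (hS : StackState r c Q h j T) (hQ : IsSYT r c Q) (hr : 1 ≤ r) (hc : 1 ≤ c)
    (hj : j < r * c) :
    ∃ k < c, 0 < h k ∧
      StackState r c Q (Function.update h k (h k - 1)) (j + 1) (gromotion (2 * r) c T) ∧
      slideInto (2 * r) c T r = Q (r - h k) k + r * c ∧
      slidePath (2 * r) c T (h k - 1 + k) = (h k - 1, k) ∧
      (∀ m, h k - 1 + k < m → m ≤ 2 * r + c - 2 →
        r * c < T (slidePath (2 * r) c T m).1 (slidePath (2 * r) c T m).2) := by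
  obtain ⟨k, hk, hpos, hv, hgt, hnext⟩ := hS.exists_corner hr hc hj
  have hR : 1 ≤ 2 * r := by omega
  have hT := hS.increasing
  have hle := hS.height_le k hk
  have hvert {s : ℕ} (hs : s ≤ r) := hS.slidePath_vertical hQ hr hc hk hpos hv hnext hs
  have h00 := hS.zero_zero hr hc hj
  have hmax : 2 * (r * c) ≤ maxEntry (2 * r) c T := by
    obtain ⟨⟨s, k'⟩, ⟨hs, hk'⟩, e⟩ :=
      hQ.2.2.surjOn (show r * c ∈ Set.Icc 1 (r * c) from ⟨by omega, le_rfl⟩)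
    simp only at hs hk' e
    have h1 := hS.middle s k' hs hk'
    have h2 := hS.height_le k' hk'
    have h3 := le_maxEntry (R := 2 * r) (C := c) (T := T) (i := h k' + s) (j := k')
      (by omega) hk'
    omega
  have hvle := (hS.le_iff (h k - 1) k (by omega) hk).2 (by omega)
  have hpath_le {m : ℕ} (hm : m ≤ h k - 1 + k) :
      T (slidePath (2 * r) c T m).1 (slidePath (2 * r) c T m).2 ≤ r * c := by
    have := hT.slidePath_le hR hc hm (by omega)
    rw [hv] at this
    exact this.trans hvle
  refine ⟨k, hk, hpos, ⟨isIncreasing_gromotion hT hR hc, ?_, ?_, ?_, ?_, ?_⟩, ?_, hv, hgt⟩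
  · intro k' hk'
    by_cases e : k' = k
    · subst e; simp; omega
    · simpa [e] using hS.height_le k' hk'
  · intro i k' hi hk'
    have hiff := hS.le_iff i k' hi hk'
    have hge := hT.le_gromotion hR hc hi hk'
    have hgoal : gromotion (2 * r) c T i k' ≤ r * c ↔ i < h k' ∧ ¬(i = h k - 1 ∧ k' = k) := by
      rw [← hiff]
      rcases gromotion_cases (T := T) hR hc i k' with ⟨rfl, rfl⟩ | ⟨m, hm, e, g⟩ | ⟨e, g⟩
      · rw [gromotion_last]
        have := hS.height_le (c - 1) (by omega)
        have hlast := hgt _ (by omega) (le_refl (2 * r + c - 2))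
        rw [slidePath_last T hR hc] at hlast
        simp only at hlast
        omega
      · rw [g]
        rcases lt_trichotomy m (h k - 1 + k) with hlt | heq | hlt
        · have h1 := hpath_le (m := m) (by omega)
          have h2 := hpath_le (m := m + 1) (by omega)
          have h3 := slidePath_sum (2 * r) c T m
          rw [e] at h1 h3
          simp only at h1 h3
          refine ⟨fun _ => ⟨h1, ?_⟩, fun _ => h2⟩
          rintro ⟨rfl, rfl⟩
          omega
        · have h1 := hgt (m + 1) (by omega) (by omega)
          rw [heq, hv, Prod.mk.injEq] at e
          exact iff_of_false (not_le.2 h1) fun h2 => h2.2 ⟨e.1.symm, e.2.symm⟩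
        · have h1 := hgt (m + 1) (by omega) (by omega)
          have h2 := hgt m (by omega) (by omega)
          rw [e] at h2
          simp [not_le.2 h1, not_le.2 h2]
      · rw [g]
        refine ⟨fun h1 => ⟨h1, ?_⟩, fun h1 => h1.1⟩
        rintro ⟨rfl, rfl⟩
        exact e _ (by omega) hv
    rw [hgoal]
    by_cases e : k' = k
    · subst e; simp; omega
    · simp [e]
  · intro s k' hs hk'
    by_cases e : k' = k
    · subst e
      have h1 := gromotion_slidePath (T := T) (R := 2 * r) (C := c) (k := h k' - 1 + k' + s)
        (by omega)
      rw [hvert hs.le, add_assoc _ s 1, hvert (Nat.succ_le_of_lt hs)] at h1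
      simp only at h1
      rw [Function.update_self, h1, ← hS.middle s k' hs hk']
      congr 1
      omega
    · rw [Function.update_of_ne e, ← hS.middle s k' hs hk']
      have hk'le := hS.height_le k' hk'
      have hval := hS.middle s k' hs hk'
      have hQpos := (hQ.mem_Icc hs hk').1
      have hoff : ∀ m ≤ 2 * r + c - 2, slidePath (2 * r) c T m ≠ (h k' + s, k') := by
        intro m hm em
        rcases le_or_gt m (h k - 1 + k) with h1 | h1
        · have := hpath_le h1
          rw [em] at this
          simp only at this
          omega
        rcases le_or_gt m (h k - 1 + k + r) with h2 | h2
        · have := hvert (s := m - (h k - 1 + k)) (by omega)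
          rw [show h k - 1 + k + (m - (h k - 1 + k)) = m by omega, em, Prod.mk.injEq] at this
          exact e this.2
        · have h3 := slidePath_mono (2 * r) c T h2.le
          rw [hvert le_rfl, em] at h3
          simp only at h3
          have h4 := hnext (by omega)
          have h5 := hS.height_antitone (show k + 1 ≤ k' by omega) hk'
          omega
      refine gromotion_of_forall_ne (fun hl => ?_) fun m hm => hoff m hm.le
      exact hoff _ le_rfl (by rw [slidePath_last T hR hc, hl.1, hl.2])
  · intro i k' hi hk'
    have hlow : ∀ a b, a < 2 * r → b < c → (a, b) ≠ (0, 0) → j + 1 < T a b := by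
      intro a b ha hb hab
      have h1 := hS.lower a b ha hb
      have h2 : T a b ≠ T 0 0 := fun e => hab (by
        have := hT.inj _ _ _ _ ha hb (by omega) hc e
        rw [this.1, this.2])
      omega
    rcases gromotion_cases (T := T) hR hc i k' with ⟨rfl, rfl⟩ | ⟨m, hm, e, g⟩ | ⟨e, g⟩
    · rw [gromotion_last]
      omega
    · rw [g]
      have hmem := slidePath_mem T hR hc (Nat.succ_le_of_lt hm)
      refine hlow _ _ hmem.1 hmem.2 fun e' => ?_
      have hs := slidePath_sum (2 * r) c T (m + 1)
      rw [Prod.mk.injEq] at e'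
      omega
    · rw [g]
      exact hlow _ _ hi hk' fun e' => e 0 (by omega) e'.symm
  · intro v hv' hvle'
    obtain ⟨i, k', hi, hk', rfl⟩ := hS.surj v (by omega) hvle'
    by_cases hon : ∃ m ≤ 2 * r + c - 2, slidePath (2 * r) c T m = (i, k')
    · obtain ⟨m, hm, e⟩ := hon
      rcases m with _ | m
      · rw [slidePath, Prod.mk.injEq] at e
        rw [← e.1, ← e.2] at hv'
        omega
      · have hmem := slidePath_mem T hR hc (k := m) (by omega)
        refine ⟨_, _, hmem.1, hmem.2, ?_⟩
        rw [gromotion_slidePath (by omega), e]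
    · push Not at hon
      refine ⟨i, k', hi, hk', gromotion_of_forall_ne (fun hl => ?_) fun m hm => hon m hm.le⟩
      exact hon _ le_rfl (by rw [slidePath_last T hR hc, hl.1, hl.2])
  · have h1 := hvert (s := r - h k) (by omega)
    have h2 := hvert (s := r - h k + 1) (by omega)
    rw [← add_assoc] at h2
    have h3 := slideInto_eq (T := T) (R := 2 * r) (C := c) (i := r - 1)
      (k := h k - 1 + k + (r - h k)) (by omega) (by rw [h1]; simp only; omega)
      (by rw [h2]; simp only; omega)
    rw [Nat.sub_add_cancel hr, h2] at h3
    rw [h3, ← hS.middle (r - h k) k (by omega) hk]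
    simp only
    congr 1
    omega

end StackState

/-! ## Removing the cells of a rectangle one at a time -/

/-- The columns of an `r × c` rectangle are emptied in `n` steps, at step `j` by removing the
corner in column `κ j`; before step `j`, column `k` has height `H j k`. -/
structure CornerRemoval (r c n : ℕ) (H : ℕ → ℕ → ℕ) (κ : ℕ → ℕ) : Prop where
  zero : ∀ k, H 0 k = r
  succ : ∀ j, j < n → H (j + 1) = Function.update (H j) (κ j) (H j (κ j) - 1)
  final : ∀ k, k < c → H n k = 0
  col_lt : ∀ j, j < n → κ j < c
  pos : ∀ j, j < n → 0 < H j (κ j)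
  antitone : ∀ j k k', j ≤ n → k ≤ k' → k' < c → H j k' ≤ H j k

namespace CornerRemoval

variable {r c n : ℕ} {H H' : ℕ → ℕ → ℕ} {κ κ' : ℕ → ℕ} {Q Q' : ℕ → ℕ → ℕ}

theorem height_mono (h : CornerRemoval r c n H κ) {j j' : ℕ} (hj : j ≤ j') (hj' : j' ≤ n)
    (k : ℕ) : H j' k ≤ H j k := by
  induction j', hj using Nat.le_induction with
  | base => exact le_rfl
  | succ m _ ih =>
    refine le_trans ?_ (ih (by omega))
    rw [h.succ m (by omega), Function.update_apply]
    split_ifs with e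
    · rw [e]; omega
    · exact le_rfl

theorem height_le (h : CornerRemoval r c n H κ) {j : ℕ} (hj : j ≤ n) (k : ℕ) : H j k ≤ r :=
  (h.height_mono (Nat.zero_le j) hj k).trans (h.zero k).le

theorem exists_removal (h : CornerRemoval r c n H κ) {i j k : ℕ} (hj : j ≤ n) (hk : k < c)
    (hi : i < H j k) : ∃ j', j ≤ j' ∧ j' < n ∧ κ j' = k ∧ H j' k = i + 1 := by
  induction hj using Nat.decreasingInduction with
  | self => rw [h.final k hk] at hi; omega
  | of_succ m hm ih =>
    by_cases hlt : i < H (m + 1) k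
    · obtain ⟨j', h1, h2⟩ := ih hlt
      exact ⟨j', by omega, h2⟩
    · rw [h.succ m hm, Function.update_apply] at hlt
      split_ifs at hlt with e
      · subst e
        exact ⟨m, le_rfl, hm, rfl, by omega⟩
      · exact absurd hi hlt

/-- Later removals with a smaller entry of `Q` in the vertically reflected cell occur in columns
further to the left. -/
theorem col_lt_of_lt (h : CornerRemoval r c n H κ) (hQ : IsIncreasing r c Q) {j j' : ℕ}
    (hjj' : j' < j) (hj : j < n)
    (hlt : Q (r - H j (κ j)) (κ j) < Q (r - H j' (κ j')) (κ j')) : κ j < κ j' := by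
  by_contra! hle
  have h1 := h.antitone j _ _ hj.le hle (h.col_lt j hj)
  have h2 := h.height_mono hjj' hj.le (κ j')
  rw [h.succ j' (by omega), Function.update_self] at h2
  have h3 := h.pos j' (by omega)
  have h4 := h.pos j hj
  have h5 := h.height_le (j := j') (by omega) (κ j')
  exact absurd hlt (not_lt.2 (hQ.mono (by omega) (by omega) hle (h.col_lt j hj)))

theorem exists_later_lt (h : CornerRemoval r c n H κ) (hQ : IsIncreasing r c Q) {j k : ℕ}
    (hj : j < n) (hk : κ j = k + 1) :
    ∃ j', j < j' ∧ j' < n ∧ κ j' = k ∧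
      Q (r - H j' (κ j')) (κ j') < Q (r - H j (κ j)) (κ j) := by
  have hc := h.col_lt j hj
  have hpos := h.pos j hj
  have hle := h.height_le hj.le (k + 1)
  rw [hk] at hc hpos
  have hanti := h.antitone j k (k + 1) hj.le (Nat.le_succ k) hc
  obtain ⟨j', h1, h2, h3, h4⟩ :=
    h.exists_removal (i := H j (k + 1) - 1) (k := k) hj.le (by omega) (by omega)
  refine ⟨j', ?_, h2, h3, ?_⟩
  · rcases h1.eq_or_lt with rfl | h1
    · omega
    · exact h1
  · rw [h3, hk, h4, Nat.sub_add_cancel hpos]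
    exact hQ.row _ _ (by omega) hc

theorem col_le (h : CornerRemoval r c n H κ) (h' : CornerRemoval r c n H' κ')
    (hQ : IsIncreasing r c Q) (hQ' : IsIncreasing r c Q')
    (heq : ∀ j, j < n → Q (r - H j (κ j)) (κ j) = Q' (r - H' j (κ' j)) (κ' j)) {j : ℕ}
    (hj : j < n) : κ j ≤ κ' j := by
  induction hk : κ j generalizing j with
  | zero => exact Nat.zero_le _
  | succ k ih =>
    obtain ⟨j', h1, h2, h3, h4⟩ := h.exists_later_lt hQ hj hk
    have h5 := ih h2 h3
    rw [heq j hj, heq j' h2] at h4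
    have h6 := h'.col_lt_of_lt hQ' h1 h2 h4
    omega

theorem height_eq (h : CornerRemoval r c n H κ) (h' : CornerRemoval r c n H' κ')
    (hκ : ∀ j, j < n → κ j = κ' j) {j : ℕ} (hj : j ≤ n) : H j = H' j := by
  induction j with
  | zero => funext k; rw [h.zero, h'.zero]
  | succ j ih => rw [h.succ j hj, h'.succ j hj, ih (by omega), hκ j hj]

theorem eq_of_entry_eq (h : CornerRemoval r c n H κ)
    (heq : ∀ j, j < n → Q (r - H j (κ j)) (κ j) = Q' (r - H j (κ j)) (κ j)) {s k : ℕ}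
    (hs : s < r) (hk : k < c) : Q s k = Q' s k := by
  obtain ⟨j, -, h2, rfl, h4⟩ := h.exists_removal (i := r - s - 1) (k := k) (Nat.zero_le n) hk
    (by rw [h.zero]; omega)
  have := heq j h2
  rwa [h4, show r - (r - s - 1 + 1) = s by omega] at this

end CornerRemoval

/-! ## Injectivity -/

/-- The first `n` gromotions of a stacked tableau. -/
theorem exists_cornerRemoval_stack {r c : ℕ} (hr : 1 ≤ r) (hc : 1 ≤ c) {P Q : ℕ → ℕ → ℕ}
    (hP : IsSYT r c P) (hQ : IsSYT r c Q) :
    ∃ H κ, CornerRemoval r c (r * c) H κ ∧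
      (∀ j, j ≤ r * c →
        StackState r c Q (H j) j ((gromotion (2 * r) c)^[j] (stack r c P Q))) ∧
      ∀ j, j < r * c →
        slideInto (2 * r) c ((gromotion (2 * r) c)^[j] (stack r c P Q)) r =
          Q (r - H j (κ j)) (κ j) + r * c ∧
        slidePath (2 * r) c ((gromotion (2 * r) c)^[j] (stack r c P Q)) (H j (κ j) - 1 + κ j) =
          (H j (κ j) - 1, κ j) ∧
        ∀ m, H j (κ j) - 1 + κ j < m → m ≤ 2 * r + c - 2 →
          r * c < (gromotion (2 * r) c)^[j] (stack r c P Q)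
            (slidePath (2 * r) c ((gromotion (2 * r) c)^[j] (stack r c P Q)) m).1
            (slidePath (2 * r) c ((gromotion (2 * r) c)^[j] (stack r c P Q)) m).2 := by
  have hstep := fun h j T (hS : StackState r c Q h j T) (hj : j < r * c) =>
    hS.step hQ hr hc hj
  choose! f hf using hstep
  let T : ℕ → ℕ → ℕ → ℕ := fun j => (gromotion (2 * r) c)^[j] (stack r c P Q)
  let H : ℕ → ℕ → ℕ := fun j => Nat.rec (fun _ => r)
    (fun j h => Function.update h (f h j (T j)) (h (f h j (T j)) - 1)) j
  have hstate : ∀ j, j ≤ r * c → StackState r c Q (H j) j (T j) := by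
    intro j
    induction j with
    | zero => exact fun _ => stackState_stack hP hQ
    | succ j ih =>
      intro hj
      have := (hf (H j) j (T j) (ih (by omega)) hj).2.2.1
      simpa only [T, Function.iterate_succ_apply'] using this
  refine ⟨H, fun j => f (H j) j (T j), ⟨fun _ => rfl, fun _ _ => rfl, ?_, ?_, ?_, ?_⟩,
    hstate, fun j hj => (hf _ _ _ (hstate j hj.le) hj).2.2.2⟩
  · exact fun k hk => (hstate _ le_rfl).height_eq_zero hr hk
  · exact fun j hj => (hf _ _ _ (hstate j hj.le) hj).1
  · exact fun j hj => (hf _ _ _ (hstate j hj.le) hj).2.1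
  · exact fun j k k' hj hk hk' => (hstate j hj).height_antitone hk hk'

theorem promPerm_succ_eq {r c j a : ℕ} {T : ℕ → ℕ → ℕ} (ha : 1 ≤ a) (ha' : a ≤ r * c)
    (h : slideInto (2 * r) c ((gromotion (2 * r) c)^[j] T) r = a + r * c) :
    promPerm (2 * r) c T r (j + 1) = a + r * c := by
  rw [promPerm, Nat.add_sub_cancel, h, Nat.mod_eq_of_lt (by rw [mul_assoc]; omega)]
  omega


/-- The map `SYT^stacked(2r × c) → S_{2n}`, `S ↦ prom_r(S)`, is injective:
if the `r`-th promotion permutations of two stacked tableaux agree on `{1, …, 2n}`, then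
the underlying pairs of tableaux agree. -/
theorem promPerm_stack_injective (r c : ℕ) (hr : 1 ≤ r) (hc : 1 ≤ c)
    (P Q P' Q' : ℕ → ℕ → ℕ) (hP : IsSYT r c P) (hQ : IsSYT r c Q)
    (hP' : IsSYT r c P') (hQ' : IsSYT r c Q')
    (h : ∀ j ∈ Set.Icc 1 (2 * (r * c)),
      promPerm (2 * r) c (stack r c P Q) r j =
      promPerm (2 * r) c (stack r c P' Q') r j) :
    ∀ i j, i < r → j < c → P i j = P' i j ∧ Q i j = Q' i j := by
  obtain ⟨H, κ, hH, hS, hs⟩ := exists_cornerRemoval_stack hr hc hP hQ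
  obtain ⟨H', κ', hH', hS', hs'⟩ := exists_cornerRemoval_stack hr hc hP' hQ'
  have hent : ∀ j, j < r * c → Q (r - H j (κ j)) (κ j) = Q' (r - H' j (κ' j)) (κ' j) := by
    intro j hj
    have h1 := hQ.mem_Icc (i := r - H j (κ j)) (by have := hH.pos j hj; omega) (hH.col_lt j hj)
    have h2 := hQ'.mem_Icc (i := r - H' j (κ' j)) (by have := hH'.pos j hj; omega)
      (hH'.col_lt j hj)
    have h3 := h (j + 1) ⟨by omega, by omega⟩
    rw [promPerm_succ_eq h1.1 h1.2 (hs j hj).1, promPerm_succ_eq h2.1 h2.2 (hs' j hj).1] at h3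
    exact Nat.add_right_cancel h3
  have hκ : ∀ j, j < r * c → κ j = κ' j := fun j hj =>
    (hH.col_le hH' hQ.isIncreasing hQ'.isIncreasing hent hj).antisymm
      (hH'.col_le hH hQ'.isIncreasing hQ.isIncreasing (fun j hj => (hent j hj).symm) hj)
  have hHeq : ∀ j, j ≤ r * c → H j = H' j := fun j hj => hH.height_eq hH' hκ hj
  have hTop : ∀ j, j ≤ r * c → ∀ i k, i < H j k ∧ k < c →
      (gromotion (2 * r) c)^[j] (stack r c P Q) i k =
        (gromotion (2 * r) c)^[j] (stack r c P' Q') i k := by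
    intro j hj
    induction hj using Nat.decreasingInduction with
    | self =>
      rintro i k ⟨hi, hk⟩
      rw [hH.final k hk] at hi
      omega
    | of_succ j hj ih =>
      have hst := hS j hj.le
      have hst' := hS' j hj.le
      have hsj := (hs j hj).2
      have hsj' := (hs' j hj).2
      rw [← hκ j hj, ← hHeq j hj.le] at hsj'
      rw [← hHeq j hj.le] at hst'
      have hpos := hH.pos j hj
      have hcol := hH.col_lt j hj
      have hle := hH.height_le hj.le (κ j)
      have hout {S : ℕ → ℕ → ℕ} {U : ℕ → ℕ → ℕ} (hU : StackState r c S (H j) j U) {m : ℕ}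
          (hm : m ≤ 2 * r + c - 2)
          (hgt : r * c < U (slidePath (2 * r) c U m).1 (slidePath (2 * r) c U m).2) :
          ¬ ((slidePath (2 * r) c U m).1 < H j (slidePath (2 * r) c U m).2 ∧
            (slidePath (2 * r) c U m).2 < c) := by
        have hmem := slidePath_mem U (R := 2 * r) (by omega) hc hm
        intro hin
        exact absurd ((hU.le_iff _ _ hmem.1 hmem.2).2 hin.1) (not_le.2 hgt)
      refine hst.increasing.eq_of_gromotion_eq hst'.increasing (by omega) hc
        (fun i k => i < H j k ∧ k < c) ?_ ?_ (a := H j (κ j) - 1) (b := κ j)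
        ⟨by omega, hcol⟩ (by omega) hsj.1 hsj'.1
        (fun m hm hm' => hout hst hm' (hsj.2 m hm hm'))
        (fun m hm hm' => hout hst' hm' (hsj'.2 m hm hm')) ?_
      · rintro i k i' k' ⟨hi, hk⟩ hi' hk'
        have := hH.antitone j k' k hj.le hk' hk
        exact ⟨by omega, by omega⟩
      · rw [hst.zero_zero hr hc hj, hst'.zero_zero hr hc hj]
      · rintro i k ⟨hi, hk⟩ hne
        rw [← Function.iterate_succ_apply' (gromotion (2 * r) c),
          ← Function.iterate_succ_apply' (gromotion (2 * r) c)]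
        refine ih i k ⟨?_, hk⟩
        rw [hH.succ j hj, Function.update_apply]
        split_ifs with e
        · subst e
          omega
        · exact hi
  intro i j hi hj
  constructor
  · have := hTop 0 (Nat.zero_le _) i j ⟨by rw [hH.zero]; exact hi, hj⟩
    simpa [stack, hi] using this
  · refine hH.eq_of_entry_eq (fun m hm => ?_) hi hj
    rw [hent m hm, ← hκ m hm, ← hHeq m hm.le]

end PromRS
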